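/- Let F : ℝ^p → ℝ be a convex three times differentiable function such that for all w, v ∈ ℝ^p the function g(t) = F(w + t·v) satisfies |g'''(t)| ≤ R·‖v‖₂·g''(t) for all t ∈ ℝ, for some R ≥ 0. Then for all w, v ∈ ℝ^p with v ≠ 0: F(w+v) ≤ F(w) + vᵀF'(w) + (vᵀF''(w)v / (R²‖v‖₂²))·(e^{R‖v‖₂} − R‖v‖₂ − 1). -/

import Mathlib

/-- The upper Taylor-expansion coefficient: for `a = R·‖v‖ ≠ 0` it equals
`c / a² · (e^{a} - a - 1)` (with `c = vᵀF''(w)v`), and for `a = 0` it is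
interpreted by continuity as `c / 2`. -/
noncomputable def upCoef (c a : ℝ) : ℝ :=
  if a = 0 then c / 2 else c / a ^ 2 * (Real.exp a - a - 1)

/-- Two functions on the line, ordered at `0` and with ordered derivatives on `[0, ∞)`,
are ordered on `[0, ∞)`. -/
theorem le_of_hasDerivAt_le_of_nonneg {f k f' k' : ℝ → ℝ}
    (hf : ∀ t, HasDerivAt f (f' t) t) (hk : ∀ t, HasDerivAt k (k' t) t)
    (h : ∀ t, 0 ≤ t → f' t ≤ k' t) (h0 : f 0 ≤ k 0) {t : ℝ} (ht : 0 ≤ t) : f t ≤ k t := by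
  have hd : ∀ s, HasDerivAt (fun s => k s - f s) (k' s - f' s) s := fun s => (hk s).sub (hf s)
  have hm : MonotoneOn (fun s => k s - f s) (Set.Ici 0) := by
    refine monotoneOn_of_deriv_nonneg (convex_Ici 0)
      (fun s _ => (hd s).continuousAt.continuousWithinAt)
      (fun s _ => (hd s).differentiableAt.differentiableWithinAt) fun s hs => ?_
    rw [(hd s).deriv]
    exact sub_nonneg.2 (h s (interior_subset hs))
  have := hm Set.self_mem_Ici ht ht
  simp only at this
  linarith

/-- Grönwall's inequality for a scalar function. -/
theorem le_mul_exp_of_hasDerivAt_le {f f' : ℝ → ℝ} {a : ℝ}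
    (hf : ∀ t, HasDerivAt f (f' t) t) (h : ∀ t, f' t ≤ a * f t) {t : ℝ} (ht : 0 ≤ t) :
    f t ≤ f 0 * Real.exp (a * t) := by
  have he : ∀ s, HasDerivAt (fun s => Real.exp (-(a * s))) (Real.exp (-(a * s)) * -a) s := by
    intro s
    simpa using ((hasDerivAt_id s).const_mul a).neg.exp
  have key : f t * Real.exp (-(a * t)) ≤ f 0 := by
    refine le_of_hasDerivAt_le_of_nonneg (fun s => (hf s).mul (he s))
      (fun s => hasDerivAt_const s (f 0)) (fun s _ => ?_) (by simp) ht
    have := mul_le_mul_of_nonneg_right (h s) (Real.exp_pos (-(a * s))).le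
    linarith
  have := mul_le_mul_of_nonneg_right key (Real.exp_pos (a * t)).le
  rwa [mul_assoc, ← Real.exp_add, neg_add_cancel, Real.exp_zero, mul_one] at this

/-- Differentiating the diagonal of an iterated derivative along a line. -/
theorem ContDiff.hasDerivAt_iteratedFDeriv_line {E G : Type*}
    [NormedAddCommGroup E] [NormedSpace ℝ E] [NormedAddCommGroup G] [NormedSpace ℝ G]
    {F : E → G} {N : WithTop ℕ∞} (hF : ContDiff ℝ N F) {n : ℕ} (hn : (n : WithTop ℕ∞) < N)
    (w v : E) (t : ℝ) :
    HasDerivAt (fun s : ℝ => iteratedFDeriv ℝ n F (w + s • v) fun _ => v)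
      (iteratedFDeriv ℝ (n + 1) F (w + t • v) fun _ => v) t := by
  have hl : HasDerivAt (fun s : ℝ => w + s • v) v t := by
    simpa using ((hasDerivAt_id t).smul_const v).const_add w
  have hD := (hF.differentiable_iteratedFDeriv hn (w + t • v)).hasFDerivAt.comp_hasDerivAt t hl
  rw [iteratedFDeriv_succ_apply_left]
  exact (ContinuousMultilinearMap.apply ℝ (fun _ : Fin n => E) G
    fun _ => v).hasFDerivAt.comp_hasDerivAt t hD

/-- The upper Taylor expansion on the line for functions whose third derivative
is at most `a` times the second. -/
theorem le_add_upCoef_of_hasDerivAt {g g₁ g₂ g₃ : ℝ → ℝ} {a : ℝ}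
    (h₀ : ∀ t, HasDerivAt g (g₁ t) t) (h₁ : ∀ t, HasDerivAt g₁ (g₂ t) t)
    (h₂ : ∀ t, HasDerivAt g₂ (g₃ t) t) (h : ∀ t, g₃ t ≤ a * g₂ t) :
    g 1 ≤ g 0 + g₁ 0 + upCoef (g₂ 0) a := by
  have hg₂ : ∀ t, 0 ≤ t → g₂ t ≤ g₂ 0 * Real.exp (a * t) := fun t ht =>
    le_mul_exp_of_hasDerivAt_le h₂ h ht
  have taylor : ∀ k k₁ : ℝ → ℝ, (∀ t, HasDerivAt k (k₁ t) t) →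
      (∀ t, HasDerivAt k₁ (Real.exp (a * t)) t) → k 0 = 0 → k₁ 0 = 0 →
      g 1 ≤ g 0 + g₁ 0 + g₂ 0 * k 1 := by
    intro k k₁ hk hk₁ k0 k10
    have hg₁ : ∀ t, 0 ≤ t → g₁ t ≤ g₁ 0 + g₂ 0 * k₁ t := fun t ht =>
      le_of_hasDerivAt_le_of_nonneg h₁ (fun s => ((hk₁ s).const_mul (g₂ 0)).const_add (g₁ 0))
        hg₂ (by simp [k10]) ht
    have hg := le_of_hasDerivAt_le_of_nonneg h₀
      (fun s => ((((hasDerivAt_id s).const_mul (g₁ 0)).const_add (g 0)).add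
        ((hk s).const_mul (g₂ 0))))
      (fun s hs => by simpa using hg₁ s hs) (by simp [k0]) zero_le_one
    simpa using hg
  unfold upCoef
  split_ifs with ha
  · subst ha
    have := taylor (fun t => t ^ 2 / 2) (fun t => t)
      (fun t => by simpa using (hasDerivAt_pow 2 t).div_const 2)
      (fun t => by simpa using hasDerivAt_id' t) (by simp) rfl
    simpa [div_eq_mul_inv] using this
  · have he : ∀ t, HasDerivAt (fun s => Real.exp (a * s)) (Real.exp (a * t) * a) t := by
      intro t
      simpa using ((hasDerivAt_id t).const_mul a).exp
    have := taylor (fun t => (Real.exp (a * t) - a * t - 1) / a ^ 2)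
      (fun t => (Real.exp (a * t) - 1) / a)
      (fun t => by
        refine ((((he t).sub ((hasDerivAt_id' t).const_mul a)).sub_const 1).div_const
          (a ^ 2)).congr_deriv ?_
        field_simp)
      (fun t => by
        refine (((he t).sub_const 1).div_const a).congr_deriv ?_
        field_simp)
      (by simp) (by simp)
    convert this using 2
    simp only [mul_one]
    ring

/-- Let `F : ℝ^p → ℝ` be a convex three times differentiable function
such that for all `w, v ∈ ℝ^p` the function `g(t) = F(w + t·v)` satisfies
`|g'''(t)| ≤ R·‖v‖₂·g''(t)` for all `t ∈ ℝ`, for some `R ≥ 0` (equivalently, the third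
directional differential satisfies `|F'''(w)[v,v,v]| ≤ R·‖v‖₂·F''(w)[v,v]` everywhere).
Then for all `w, v ∈ ℝ^p` with `v ≠ 0`:
`F(w+v) ≤ F(w) + vᵀF'(w) + (vᵀF''(w)v / (R²‖v‖₂²))·(e^{R‖v‖₂} − R‖v‖₂ − 1)`. -/
theorem upper_taylor_expansion_multivariate
    (p : ℕ) (F : EuclideanSpace ℝ (Fin p) → ℝ) (R : ℝ) (hR : 0 ≤ R)
    (hconv : ConvexOn ℝ Set.univ F) (hF : ContDiff ℝ 3 F)
    (hctrl : ∀ w v : EuclideanSpace ℝ (Fin p),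
      |iteratedFDeriv ℝ 3 F w ![v, v, v]| ≤ R * ‖v‖ * iteratedFDeriv ℝ 2 F w ![v, v]) :
    ∀ w v : EuclideanSpace ℝ (Fin p), v ≠ 0 →
      F (w + v) ≤
        F w + fderiv ℝ F w v + upCoef (iteratedFDeriv ℝ 2 F w ![v, v]) (R * ‖v‖) := by
  intro w v _
  have e₂ : (![v, v] : Fin 2 → EuclideanSpace ℝ (Fin p)) = fun _ => v := by
    ext i; fin_cases i <;> rfl
  have e₃ : (![v, v, v] : Fin 3 → EuclideanSpace ℝ (Fin p)) = fun _ => v := by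
    ext i; fin_cases i <;> rfl
  have h := le_add_upCoef_of_hasDerivAt
    (hF.hasDerivAt_iteratedFDeriv_line (n := 0) (by norm_num) w v)
    (hF.hasDerivAt_iteratedFDeriv_line (n := 1) (by norm_num) w v)
    (hF.hasDerivAt_iteratedFDeriv_line (n := 2) (by norm_num) w v)
    (a := R * ‖v‖) (fun t => by
      have := (le_abs_self _).trans (hctrl (w + t • v) v)
      rwa [e₃, e₂] at this)
  rw [e₂]
  simpa using h
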